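/- arXiv:1501.07033 — 4 statements merged into one kernel-verified Lean document; each statement's English description precedes it below -/
import Mathlib

section
/- Let F be a finite field and n a positive integer. Let A, ΔA, B₀, B₁ ∈ F^{n×n}, let X₀, S ∈ GL(n, F), and set X₁ = X₀·S. Define Y₀ = A·X₀ + B₀ and Y₁ = (A + ΔA)·X₁ + B₁, and suppose Y₀ is invertible. Then the effective error matrix E = Y₀⁻¹·Y₁ − S satisfies rank(E) ≤ rank(B₀) + rank(B₁) + rank(ΔA). -/
/-- The rank of matrices is subadditive. -/
theorem Matrix.rank_add_le_add_rank {K m n : Type*} [Field K] [Finite m] [Fintype n]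
    (M N : Matrix m n K) : (M + N).rank ≤ M.rank + N.rank := by
  have hrange : LinearMap.range (M + N).mulVecLin ≤
      LinearMap.range M.mulVecLin ⊔ LinearMap.range N.mulVecLin := by
    rw [Matrix.mulVecLin_add]
    exact LinearMap.range_add_le _ _
  exact (Submodule.finrank_mono hrange).trans
    (Submodule.finrank_add_le_finrank_add_finrank _ _)

/-- Let `F` be a finite field and `n` a positive integer.
Let `A, ΔA, B₀, B₁ ∈ F^{n×n}`, let `X₀, S ∈ GL(n, F)`, and set `X₁ = X₀·S`.
Define `Y₀ = A·X₀ + B₀` and `Y₁ = (A + ΔA)·X₁ + B₁`, and suppose `Y₀` is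
invertible. Then the effective error matrix `E = Y₀⁻¹·Y₁ − S` satisfies
`rank E ≤ rank B₀ + rank B₁ + rank ΔA`. -/
theorem dlnc_effective_error_rank_bound
    (F : Type*) [Field F] [Fintype F] (n : ℕ) (hn : 0 < n)
    (A ΔA B₀ B₁ X₀ S : Matrix (Fin n) (Fin n) F)
    (hX₀ : IsUnit X₀) (hS : IsUnit S)
    (X₁ : Matrix (Fin n) (Fin n) F) (hX₁ : X₁ = X₀ * S)
    (Y₀ Y₁ : Matrix (Fin n) (Fin n) F)
    (hY₀ : Y₀ = A * X₀ + B₀)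
    (hY₁ : Y₁ = (A + ΔA) * X₁ + B₁)
    (hY₀unit : IsUnit Y₀)
    (E : Matrix (Fin n) (Fin n) F) (hE : E = Y₀⁻¹ * Y₁ - S) :
    E.rank ≤ B₀.rank + B₁.rank + ΔA.rank := by
  have hdet : IsUnit Y₀.det := (Matrix.isUnit_iff_isUnit_det Y₀).mp hY₀unit
  have hY : Y₁ = Y₀ * S + (B₀ * (-S) + B₁ + ΔA * X₁) := by
    rw [hY₁, hY₀, hX₁]
    noncomm_ring
  have hE' : E = Y₀⁻¹ * (B₀ * (-S) + B₁ + ΔA * X₁) := by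
    rw [hE, hY, Matrix.mul_add, Matrix.nonsing_inv_mul_cancel_left _ _ hdet, add_sub_cancel_left]
  calc E.rank ≤ (B₀ * (-S) + B₁ + ΔA * X₁).rank := hE' ▸ Matrix.rank_mul_le_right _ _
    _ ≤ (B₀ * (-S)).rank + B₁.rank + (ΔA * X₁).rank :=
      (Matrix.rank_add_le_add_rank _ _).trans
        (Nat.add_le_add_right (Matrix.rank_add_le_add_rank _ _) _)
    _ ≤ B₀.rank + B₁.rank + ΔA.rank := by
      gcongr <;> exact Matrix.rank_mul_le_left _ _
end

section
/- Let F be a finite field and n a positive integer. Let A, ΔA, B₀, B₁, P ∈ F^{n×n}, let X₀, S ∈ GL(n, F), and set X₁ = X₀·S. Define Y₀ = A·X₀ + B₀ and Y₁ = (A + ΔA)·X₁ + B₁. Suppose Y₀⁺ ∈ F^{n×n} satisfies Y₀⁺·Y₀ = I_n + P. Then rank(Y₀⁺·Y₁ − S) ≤ rank(P) + rank(B₀) + rank(B₁) + rank(ΔA). -/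
theorem Matrix.rank_add_le_add {m n K : Type*} [Fintype m] [Fintype n] [Field K]
    (A B : Matrix m n K) : (A + B).rank ≤ A.rank + B.rank := by
  rw [Matrix.rank, Matrix.rank, Matrix.rank, Matrix.mulVecLin_add]
  exact (Submodule.finrank_mono (LinearMap.range_add_le _ _)).trans
    (Submodule.finrank_add_le_finrank_add_finrank _ _)

/-- Let `F` be a finite field and `n` a positive integer.
Let `A, ΔA, B₀, B₁, P ∈ F^{n×n}`, let `X₀, S ∈ GL(n, F)`, and set `X₁ = X₀·S`.
Define `Y₀ = A·X₀ + B₀` and `Y₁ = (A + ΔA)·X₁ + B₁`. Suppose `Y₀⁺ ∈ F^{n×n}`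
satisfies `Y₀⁺·Y₀ = I_n + P`. Then
`rank(Y₀⁺·Y₁ − S) ≤ rank P + rank B₀ + rank B₁ + rank ΔA`. -/
theorem dlnc_effective_error_rank_bound_pseudoinverse
    (F : Type*) [Field F] [Fintype F] (n : ℕ) (hn : 0 < n)
    (A ΔA B₀ B₁ P X₀ S : Matrix (Fin n) (Fin n) F)
    (hX₀ : IsUnit X₀) (hS : IsUnit S)
    (X₁ : Matrix (Fin n) (Fin n) F) (hX₁ : X₁ = X₀ * S)
    (Y₀ Y₁ Y₀p : Matrix (Fin n) (Fin n) F)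
    (hY₀ : Y₀ = A * X₀ + B₀)
    (hY₁ : Y₁ = (A + ΔA) * X₁ + B₁)
    (hY₀p : Y₀p * Y₀ = 1 + P) :
    (Y₀p * Y₁ - S).rank ≤ P.rank + B₀.rank + B₁.rank + ΔA.rank := by
  have h : Y₀p * Y₁ - S = P * S + Y₀p * B₀ * (-S) + Y₀p * B₁ + Y₀p * ΔA * X₁ := by
    have hPS : P * S = Y₀p * Y₀ * S - S := by rw [hY₀p]; noncomm_ring
    rw [hPS, hY₁, hX₁, hY₀]
    noncomm_ring
  have hB₀ : (Y₀p * B₀ * (-S)).rank ≤ B₀.rank :=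
    (Matrix.rank_mul_le_left _ _).trans (Matrix.rank_mul_le_right _ _)
  have hΔA : (Y₀p * ΔA * X₁).rank ≤ ΔA.rank :=
    (Matrix.rank_mul_le_left _ _).trans (Matrix.rank_mul_le_right _ _)
  rw [h]
  refine (Matrix.rank_add_le_add _ _).trans (add_le_add ?_ hΔA)
  refine (Matrix.rank_add_le_add _ _).trans (add_le_add ?_ (Matrix.rank_mul_le_right _ _))
  exact (Matrix.rank_add_le_add _ _).trans (add_le_add (Matrix.rank_mul_le_left _ _) hB₀)
end

section
/- Let F be a finite field and n a positive integer. Let A, B₀, B₁ ∈ F^{n×n}, let X₀, S ∈ GL(n, F), and set X₁ = X₀·S. Define Y₀ = A·X₀ + B₀ and Y₁ = A·X₁ + B₁, and suppose Y₀ is invertible. Then rank(Y₀⁻¹·Y₁ − S) ≤ rank(B₀) + rank(B₁). -/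
theorem Matrix.rank_add_le_rank_add_rank {m n K : Type*} [Fintype m] [Fintype n] [Field K]
    (M N : Matrix m n K) : (M + N).rank ≤ M.rank + N.rank := by
  unfold Matrix.rank
  rw [Matrix.mulVecLin_add]
  exact (Submodule.finrank_mono (LinearMap.range_add_le _ _)).trans
    (Submodule.finrank_add_le_finrank_add_finrank _ _)

/-- Let `F` be a finite field and `n` a positive integer.
Let `A, B₀, B₁ ∈ F^{n×n}`, let `X₀, S ∈ GL(n, F)`, and set `X₁ = X₀·S`.
Define `Y₀ = A·X₀ + B₀` and `Y₁ = A·X₁ + B₁`, and suppose `Y₀` is invertible.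
Then `rank(Y₀⁻¹·Y₁ − S) ≤ rank B₀ + rank B₁`. -/
theorem dlnc_effective_error_rank_bound_constant
    (F : Type*) [Field F] [Fintype F] (n : ℕ) (hn : 0 < n)
    (A B₀ B₁ X₀ S : Matrix (Fin n) (Fin n) F)
    (hX₀ : IsUnit X₀) (hS : IsUnit S)
    (X₁ : Matrix (Fin n) (Fin n) F) (hX₁ : X₁ = X₀ * S)
    (Y₀ Y₁ : Matrix (Fin n) (Fin n) F)
    (hY₀ : Y₀ = A * X₀ + B₀)
    (hY₁ : Y₁ = A * X₁ + B₁)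
    (hY₀unit : IsUnit Y₀) :
    (Y₀⁻¹ * Y₁ - S).rank ≤ B₀.rank + B₁.rank := by
  have h_inv : Y₀⁻¹ * Y₀ = 1 :=
    Matrix.nonsing_inv_mul Y₀ ((Matrix.isUnit_iff_isUnit_det Y₀).mp hY₀unit)
  have h_err : Y₀⁻¹ * Y₁ - S = Y₀⁻¹ * (B₀ * -S) + Y₀⁻¹ * B₁ := by
    have h_diff : Y₁ - Y₀ * S = B₀ * -S + B₁ := by
      rw [hY₁, hY₀, hX₁]
      noncomm_ring
    rw [← mul_add, ← h_diff, mul_sub, ← mul_assoc, h_inv, one_mul]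
  rw [h_err]
  exact (Matrix.rank_add_le_rank_add_rank _ _).trans <| add_le_add
    ((Matrix.rank_mul_le_right _ _).trans (Matrix.rank_mul_le_left _ _))
    (Matrix.rank_mul_le_right _ _)
end

section
/- Let F be a field, n a positive integer, and Y ∈ F^{n×n} with rank r. Then there exist a matrix Y⁺ ∈ F^{n×n}, a subset U ⊆ {1, …, n} with |U| = n − r, and a matrix L ∈ F^{n×(n−r)} with rank(L) = n − r, such that: (i) Y⁺·Y = I_n + L·I_U^T, where I_U ∈ F^{(n−r)×n} consists of the rows of I_n indexed by U; (ii) Y·Y⁺·Y = Y; and (iii) I_U^T is a right inverse up to sign in the sense that I_U·L = −I_{n−r} (equivalently, the paper's condition I_U^T L = −I_{|U|} interpreted as the (n−r)×(n−r) product of the selected rows with L). -/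
/-- The row-selection matrix `I_U ∈ F^{k×n}` consisting of the rows of the
identity matrix `I_n` indexed by the subset `U` (of cardinality `k`), listed
in increasing order. -/
def rowSelect (F : Type*) [Field F] {n k : ℕ} (U : Finset (Fin n))
    (hU : U.card = k) : Matrix (Fin k) (Fin n) F :=
  Matrix.of fun i j => if (↑(U.orderIsoOfFin hU i) : Fin n) = j then 1 else 0

theorem rowSelect_mul (F : Type*) [Field F] {n k : ℕ} (U : Finset (Fin n))
    (hU : U.card = k) {m : Type*} (A : Matrix (Fin n) m F) :
    rowSelect F U hU * A = A.submatrix (fun i => (U.orderIsoOfFin hU i : Fin n)) id := by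
  ext i j
  simp only [rowSelect, Matrix.mul_apply, Matrix.of_apply, ite_mul, one_mul, zero_mul,
    Finset.sum_ite_eq, Finset.mem_univ, if_true, Matrix.submatrix_apply, id]

theorem rowSelect_mul_transpose (F : Type*) [Field F] {n k : ℕ} (U : Finset (Fin n))
    (hU : U.card = k) : rowSelect F U hU * (rowSelect F U hU).transpose = 1 := by
  rw [rowSelect_mul]
  ext i j
  simp [rowSelect, Matrix.one_apply, eq_comm]

theorem mul_transpose_rowSelect_mul (F : Type*) [Field F] {n k : ℕ} (U : Finset (Fin n))
    (hU : U.card = k) {m : Type*} (A : Matrix m (Fin n) F) (hA : ∀ i, ∀ j ∉ U, A i j = 0) :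
    A * (rowSelect F U hU).transpose * rowSelect F U hU = A := by
  have hcol (i : m) (l : Fin k) : (A * (rowSelect F U hU).transpose) i l =
      A i (U.orderIsoOfFin hU l) := by
    simp only [rowSelect, Matrix.mul_apply, Matrix.transpose_apply, Matrix.of_apply, mul_ite,
      mul_one, mul_zero, Finset.sum_ite_eq, Finset.mem_univ, if_true]
  ext i j
  rw [Matrix.mul_apply]
  simp only [hcol]
  by_cases hj : j ∈ U
  · obtain ⟨l, hl⟩ := (U.orderIsoOfFin hU).surjective ⟨j, hj⟩
    rw [Finset.sum_eq_single l]
    · simp [rowSelect, -Finset.coe_orderIsoOfFin_apply, hl]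
    · intro b _ hb
      have : (U.orderIsoOfFin hU b : Fin n) ≠ j := fun h =>
        hb ((U.orderIsoOfFin hU).injective (by rw [hl]; exact Subtype.ext h))
      simp [rowSelect, -Finset.coe_orderIsoOfFin_apply, this]
    · simp
  · rw [hA i j hj]
    refine Finset.sum_eq_zero fun b _ => ?_
    have : (U.orderIsoOfFin hU b : Fin n) ≠ j := fun h => hj (h ▸ (U.orderIsoOfFin hU b).2)
    simp [rowSelect, -Finset.coe_orderIsoOfFin_apply, this]

open scoped Matrix in
/-- A generalized inverse `G` of `Y` for which `G * Y` is a projection onto the coordinate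
subspace of a set `S` of columns of `Y` forming a basis of its column space. -/
theorem Matrix.exists_generalizedInverse_of_columnBasis {F m n : Type*} [Field F] [Fintype m]
    [Fintype n] [DecidableEq n] (Y : Matrix m n F) :
    ∃ (S : Finset n) (G : Matrix n m F), S.card = Y.rank ∧ Y * G * Y = Y ∧
      (∀ i ∉ S, ∀ j, G i j = 0) ∧ ∀ i, ∀ j ∈ S, (G * Y) i j = (1 : Matrix n n F) i j := by
  classical
  obtain ⟨b, -, -, hspan, hli⟩ := exists_linearIndepOn_extension
    (linearIndepOn_empty F Y.col) (Set.empty_subset Set.univ)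
  obtain ⟨g, hg⟩ :=
    (Finsupp.linearCombination F fun s : b => Y.col s).exists_leftInverse_of_injective
      (LinearMap.ker_eq_bot.2 hli)
  set E : (b →₀ F) →ₗ[F] (n → F) :=
    Finsupp.linearCombination F fun s : b => Pi.single (s : n) (1 : F) with hE
  have hgs (s : b) : E (g (Y.col s)) = Pi.single (s : n) (1 : F) := by
    have := LinearMap.congr_fun hg (Finsupp.single s 1)
    simp only [LinearMap.comp_apply, Finsupp.linearCombination_single, one_smul,
      LinearMap.id_apply] at this
    rw [this]
    simp [hE]
  have hzero (x : b →₀ F) (i : n) (hi : i ∉ b) : E x i = 0 := by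
    simp only [hE, Finsupp.linearCombination_apply, Finsupp.sum, Finset.sum_apply, Pi.smul_apply]
    refine Finset.sum_eq_zero fun s _ => ?_
    rw [Pi.single_eq_of_ne (fun h : i = s => hi (h ▸ s.2)), smul_zero]
  have hmulVec (x : m → F) : (LinearMap.toMatrix' (E ∘ₗ g)) *ᵥ x = E (g x) := by
    rw [LinearMap.toMatrix'_mulVec]; rfl
  have hmul (j : n) : (LinearMap.toMatrix' (E ∘ₗ g) * Y).col j = E (g (Y.col j)) := by
    rw [← hmulVec]; rfl
  have hid : Set.EqOn (Y.mulVecLin ∘ₗ E ∘ₗ g) (LinearMap.id : (m → F) →ₗ[F] m → F)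
      (Submodule.span F (Y.col '' b)) := by
    refine LinearMap.eqOn_span ?_
    rintro _ ⟨s, hs, rfl⟩
    simp [hgs ⟨s, hs⟩]
  refine ⟨b.toFinset, LinearMap.toMatrix' (E ∘ₗ g), ?_, ?_, ?_, ?_⟩
  · have hspan' : Submodule.span F (Set.range Y.col) =
        Submodule.span F (Set.range fun s : b => Y.col s) := by
      apply le_antisymm
      · rw [Submodule.span_le, ← Set.image_univ, ← Set.image_eq_range]
        exact hspan
      · exact Submodule.span_mono (by rintro _ ⟨s, rfl⟩; exact ⟨s, rfl⟩)
    rw [Matrix.rank_eq_finrank_span_cols, hspan', finrank_span_eq_card hli, Set.toFinset_card]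
  · ext i j
    have := hid (hspan ⟨j, Set.mem_univ j, rfl⟩)
    simp only [LinearMap.comp_apply, ← hmul, LinearMap.id_apply] at this
    rw [Matrix.mul_assoc]
    exact congrFun this i
  · intro i hi j
    rw [LinearMap.toMatrix'_apply]
    exact hzero _ _ (by simpa using hi)
  · intro i j hj
    have := congrFun ((hmul j).trans (hgs ⟨j, by simpa using hj⟩)) i
    rw [Matrix.one_apply]
    simpa [Pi.single_apply] using this

/-- Let `F` be a field, `n` a positive integer, and
`Y ∈ F^{n×n}` with rank `r`. Then there exist `Y⁺ ∈ F^{n×n}`, a subset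
`U ⊆ {1, …, n}` with `|U| = n − r`, and `L ∈ F^{n×(n−r)}` with
`rank L = n − r`, such that (i) `Y⁺·Y = I_n + L·I_U`, where `I_U` consists of
the rows of `I_n` indexed by `U`; (ii) `Y·Y⁺·Y = Y`; and
(iii) `I_U·L = −I_{n−r}`. -/
theorem exists_dlnc_pseudoinverse
    (F : Type*) [Field F] (n : ℕ) (hn : 0 < n)
    (Y : Matrix (Fin n) (Fin n) F) :
    ∃ (Yp : Matrix (Fin n) (Fin n) F) (U : Finset (Fin n))
      (hU : U.card = n - Y.rank) (L : Matrix (Fin n) (Fin (n - Y.rank)) F),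
      L.rank = n - Y.rank ∧
      Yp * Y = 1 + L * rowSelect F U hU ∧
      Y * Yp * Y = Y ∧
      rowSelect F U hU * L = -1 := by
  obtain ⟨S, G, hS, hYGY, hG, hGY⟩ := Y.exists_generalizedInverse_of_columnBasis
  have hU : Sᶜ.card = n - Y.rank := by rw [Finset.card_compl, Fintype.card_fin, hS]
  have hIG : rowSelect F Sᶜ hU * G = 0 := by
    rw [rowSelect_mul]
    ext i j
    exact hG _ (Finset.mem_compl.1 (Sᶜ.orderIsoOfFin hU i).2) j
  have hIL : rowSelect F Sᶜ hU * ((G * Y - 1) * (rowSelect F Sᶜ hU).transpose) = -1 := by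
    rw [← Matrix.mul_assoc, Matrix.mul_sub, ← Matrix.mul_assoc, hIG, Matrix.zero_mul, zero_sub,
      Matrix.mul_one, Matrix.neg_mul, rowSelect_mul_transpose]
  refine ⟨G, Sᶜ, hU, (G * Y - 1) * (rowSelect F Sᶜ hU).transpose, ?_, ?_, hYGY, hIL⟩
  · refine le_antisymm (Matrix.rank_le_width _) ?_
    have h := Matrix.rank_mul_le_right (rowSelect F Sᶜ hU)
      ((G * Y - 1) * (rowSelect F Sᶜ hU).transpose)
    rwa [hIL, Matrix.rank_of_isUnit (-1 : Matrix (Fin (n - Y.rank)) _ F) isUnit_one.neg,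
      Fintype.card_fin] at h
  · rw [mul_transpose_rowSelect_mul]
    · abel
    · intro i j hj
      rw [Matrix.sub_apply, hGY i j (by simpa using hj), sub_self]
end
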